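/- Let A be a commutative ring and 0 → E → F → G → 0 a short exact sequence of flat A-modules. Then for every n ≥ 0 there is an exact sequence of A-modules 0 → Γ^n(E) → Γ^n(F) → Γ^{n−1}(F) ⊗ G → ⋯ → Γ^{n−i}(F) ⊗ ∧^i G → ⋯ → ∧^n G → 0, where Γ denotes the divided power functor, and the differentials send f_1^{[m_1]}⋯f_r^{[m_r]} ⊗ ω to Σ_i f_1^{[m_1]}⋯f_i^{[m_i − 1]}⋯f_r^{[m_r]} ⊗ v(f_i) ∧ ω (v: F → G the given surjection). -/

import Mathlib

open scoped TensorProduct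

noncomputable section

variable (R : Type*) [CommRing R]
variable (E F G : Type*) [AddCommGroup E] [AddCommGroup F] [AddCommGroup G]
  [Module R E] [Module R F] [Module R G]

/-- The submodule of symmetric tensors in the `n`-th tensor power of `M`.
For a flat module `M` this is a model of the divided power module `Γ^n(M)`. -/
def SymTensor (M : Type*) [AddCommGroup M] [Module R M] (n : ℕ) :
    Submodule R (⨂[R]^n M) where
  carrier := {x | ∀ σ : Equiv.Perm (Fin n), PiTensorProduct.reindex R (fun _ => M) σ x = x}
  add_mem' := by
    intro a b ha hb σ
    simp [map_add, ha σ, hb σ]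
  zero_mem' := by
    intro σ
    simp
  smul_mem' := by
    intro c x hx σ
    simp [map_smul, hx σ]

variable {R F G} in
/-- Contraction `F ⊗ ΛG → ΛG`, `f ⊗ ω ↦ ι(v f) ∧ ω`. -/
def wedgeContract (v : F →ₗ[R] G) :
    F ⊗[R] ExteriorAlgebra R G →ₗ[R] ExteriorAlgebra R G :=
  TensorProduct.lift ((LinearMap.mul R (ExteriorAlgebra R G)).comp
    ((ExteriorAlgebra.ι R).comp v))

/-- Splitting of the tensor power: `F^{⊗(s+1)} ≃ F^{⊗s} ⊗ F`. -/
def splitPow (M : Type*) [AddCommGroup M] [Module R M] (s : ℕ) :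
    (⨂[R]^(s+1) M) ≃ₗ[R] (⨂[R]^s M) ⊗[R] M :=
  (PiTensorProduct.reindex R (fun _ => M) (finSumFinEquiv (m := s) (n := 1)).symm).trans
    (((PiTensorProduct.tmulEquiv R M).symm).trans
      (TensorProduct.congr (LinearEquiv.refl R (⨂[R]^s M))
        (PiTensorProduct.subsingletonEquiv (0 : Fin 1))))

variable {R E F G} in
/-- The Quillen–Illusie differential `F^{⊗(s+1)} ⊗ ΛG → F^{⊗s} ⊗ ΛG`; on divided-power
(symmetric) tensors it sends `f₁^{[m₁]}⋯f_r^{[m_r]} ⊗ ω` to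
`Σ_i f₁^{[m₁]}⋯f_i^{[m_i−1]}⋯f_r^{[m_r]} ⊗ v(f_i) ∧ ω`. -/
def qiDiff (v : F →ₗ[R] G) (s : ℕ) :
    (⨂[R]^(s+1) F) ⊗[R] ExteriorAlgebra R G →ₗ[R]
      (⨂[R]^s F) ⊗[R] ExteriorAlgebra R G :=
  (TensorProduct.map LinearMap.id (wedgeContract v)).comp
    (((TensorProduct.assoc R (⨂[R]^s F) F (ExteriorAlgebra R G)).toLinearMap).comp
      (TensorProduct.map (splitPow R F s).toLinearMap LinearMap.id))

/-- The term `Γ^s(F) ⊗ ∧^l(G)` of the Quillen–Illusie complex, realized as a submodule of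
`F^{⊗s} ⊗ ΛG`. -/
def qiTerm (s l : ℕ) : Submodule R ((⨂[R]^s F) ⊗[R] ExteriorAlgebra R G) :=
  LinearMap.range (TensorProduct.map (SymTensor R F s).subtype (⋀[R]^l G).subtype)

namespace QuillenIllusie

section Functoriality

variable {R}
variable {M M' M'' N N' N'' : Type*}
  [AddCommGroup M] [AddCommGroup M'] [AddCommGroup M'']
  [AddCommGroup N] [AddCommGroup N'] [AddCommGroup N'']
  [Module R M] [Module R M'] [Module R M''] [Module R N] [Module R N'] [Module R N'']

/-- The `s`-th tensor power of a linear map. -/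
def powMap (φ : M →ₗ[R] M') (s : ℕ) : (⨂[R]^s M) →ₗ[R] ⨂[R]^s M' :=
  PiTensorProduct.map (fun _ : Fin s => φ)

@[simp]
theorem powMap_tprod (φ : M →ₗ[R] M') (s : ℕ) (f : Fin s → M) :
    powMap φ s (PiTensorProduct.tprod R f) = PiTensorProduct.tprod R (fun i => φ (f i)) :=
  PiTensorProduct.map_tprod _ _

theorem powMap_comp_apply (φ' : M' →ₗ[R] M'') (φ : M →ₗ[R] M') (s : ℕ) (x : ⨂[R]^s M) :
    powMap φ' s (powMap φ s x) = powMap (φ' ∘ₗ φ) s x :=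
  (LinearMap.congr_fun (PiTensorProduct.map_comp (fun _ : Fin s => φ') (fun _ => φ)) x).symm

theorem powMap_reindex (φ : M →ₗ[R] M') (s : ℕ) (σ : Equiv.Perm (Fin s)) (x : ⨂[R]^s M) :
    powMap φ s (PiTensorProduct.reindex R (fun _ => M) σ x) =
      PiTensorProduct.reindex R (fun _ => M') σ (powMap φ s x) :=
  PiTensorProduct.map_reindex (fun _ : Fin s => φ) σ x

theorem powMap_mem_symTensor (φ : M →ₗ[R] M') (s : ℕ) {x : ⨂[R]^s M}
    (hx : x ∈ SymTensor R M s) : powMap φ s x ∈ SymTensor R M' s := by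
  intro σ
  rw [← powMap_reindex, hx σ]

theorem powMap_surjective {φ : M →ₗ[R] M'} (hφ : Function.Surjective φ) (s : ℕ) :
    Function.Surjective (powMap φ s) := by
  intro x
  induction x using PiTensorProduct.induction_on with
  | smul_tprod r f =>
    choose g hg using fun i => hφ (f i)
    exact ⟨r • PiTensorProduct.tprod R g, by simp [hg]⟩
  | add x y hx hy =>
    obtain ⟨x', rfl⟩ := hx
    obtain ⟨y', rfl⟩ := hy
    exact ⟨x' + y', map_add _ _ _⟩

theorem splitPow_tprod (s : ℕ) (f : Fin (s + 1) → M) :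
    splitPow R M s (PiTensorProduct.tprod R f) =
      PiTensorProduct.tprod R (fun i : Fin s => f i.castSucc) ⊗ₜ[R] f (Fin.last s) := by
  unfold splitPow
  simp only [LinearEquiv.trans_apply]
  erw [PiTensorProduct.reindex_tprod, PiTensorProduct.tmulEquiv_symm_apply]
  erw [TensorProduct.congr_tmul, PiTensorProduct.subsingletonEquiv_apply_tprod]
  rfl

theorem splitPow_powMap (φ : M →ₗ[R] M') (s : ℕ) (x : ⨂[R]^(s + 1) M) :
    splitPow R M' s (powMap φ (s + 1) x) =
      TensorProduct.map (powMap φ s) φ (splitPow R M s x) := by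
  induction x using PiTensorProduct.induction_on with
  | smul_tprod r f => simp [splitPow_tprod]
  | add x y hx hy => simp only [map_add, hx, hy]

theorem qiDiff_tprod_tmul (v : M →ₗ[R] N) (s : ℕ) (f : Fin (s + 1) → M)
    (ω : ExteriorAlgebra R N) :
    qiDiff v s (PiTensorProduct.tprod R f ⊗ₜ[R] ω) =
      PiTensorProduct.tprod R (fun i : Fin s => f i.castSucc) ⊗ₜ[R]
        (ExteriorAlgebra.ι R (v (f (Fin.last s))) * ω) := by
  simp [qiDiff, splitPow_tprod, wedgeContract]

/-- The map `M^{⊗s} ⊗ ΛN → M'^{⊗s} ⊗ ΛN'` induced by `M → M'` and `N → N'`. -/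
def qiMap (φ : M →ₗ[R] M') (ψ : N →ₗ[R] N') (s : ℕ) :
    (⨂[R]^s M) ⊗[R] ExteriorAlgebra R N →ₗ[R] (⨂[R]^s M') ⊗[R] ExteriorAlgebra R N' :=
  TensorProduct.map (powMap φ s) (ExteriorAlgebra.map ψ).toLinearMap

@[simp]
theorem qiMap_tmul (φ : M →ₗ[R] M') (ψ : N →ₗ[R] N') (s : ℕ) (t : ⨂[R]^s M)
    (ω : ExteriorAlgebra R N) :
    qiMap φ ψ s (t ⊗ₜ[R] ω) = powMap φ s t ⊗ₜ[R] ExteriorAlgebra.map ψ ω :=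
  rfl

theorem qiMap_comp_apply (φ' : M' →ₗ[R] M'') (φ : M →ₗ[R] M') (ψ' : N' →ₗ[R] N'')
    (ψ : N →ₗ[R] N') (s : ℕ) (x : (⨂[R]^s M) ⊗[R] ExteriorAlgebra R N) :
    qiMap φ' ψ' s (qiMap φ ψ s x) = qiMap (φ' ∘ₗ φ) (ψ' ∘ₗ ψ) s x := by
  induction x using TensorProduct.induction_on with
  | zero => simp
  | tmul t ω =>
    simp only [qiMap_tmul, powMap_comp_apply, ← ExteriorAlgebra.map_comp_map, AlgHom.comp_apply]
  | add x y hx hy => simp only [map_add, hx, hy]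

theorem qiMap_qiDiff {v : M →ₗ[R] N} {v' : M' →ₗ[R] N'} {φ : M →ₗ[R] M'} {ψ : N →ₗ[R] N'}
    (h : v' ∘ₗ φ = ψ ∘ₗ v) (s : ℕ) (x : (⨂[R]^(s + 1) M) ⊗[R] ExteriorAlgebra R N) :
    qiDiff v' s (qiMap φ ψ (s + 1) x) = qiMap φ ψ s (qiDiff v s x) := by
  have h' : ∀ m, v' (φ m) = ψ (v m) := fun m => LinearMap.congr_fun h m
  induction x using TensorProduct.induction_on with
  | zero => simp
  | tmul t ω =>
    induction t using PiTensorProduct.induction_on with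
    | smul_tprod r f =>
      simp only [← TensorProduct.smul_tmul', map_smul, qiMap_tmul, powMap_tprod,
        qiDiff_tprod_tmul, h', map_mul, ExteriorAlgebra.map_apply_ι]
    | add x y hx hy => simp only [TensorProduct.add_tmul, map_add, hx, hy]
  | add x y hx hy => simp only [map_add, hx, hy]

theorem qiTerm_eq_span (s l : ℕ) :
    qiTerm R M N s l = Submodule.span R
      {x | ∃ t ∈ SymTensor R M s, ∃ ω ∈ ⋀[R]^l N, t ⊗ₜ[R] ω = x} := by
  rw [qiTerm, TensorProduct.range_map_eq_span_tmul]
  congr 1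
  ext x
  simp

theorem tmul_mem_qiTerm {s l : ℕ} {t : ⨂[R]^s M} {ω : ExteriorAlgebra R N}
    (ht : t ∈ SymTensor R M s) (hω : ω ∈ ⋀[R]^l N) : t ⊗ₜ[R] ω ∈ qiTerm R M N s l := by
  rw [qiTerm_eq_span]
  exact Submodule.subset_span ⟨t, ht, ω, hω, rfl⟩

theorem map_mem_exteriorPower (ψ : N →ₗ[R] N') {l : ℕ} {ω : ExteriorAlgebra R N}
    (hω : ω ∈ ⋀[R]^l N) : ExteriorAlgebra.map ψ ω ∈ ⋀[R]^l N' := by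
  have h : (⋀[R]^l N).map (ExteriorAlgebra.map ψ).toLinearMap ≤ ⋀[R]^l N' := by
    rw [Submodule.map_pow, ExteriorAlgebra.ι_range_map_map]
    exact pow_le_pow_left' LinearMap.map_le_range l
  exact h ⟨ω, hω, rfl⟩

theorem qiMap_mem_qiTerm (φ : M →ₗ[R] M') (ψ : N →ₗ[R] N') {s l : ℕ}
    {x : (⨂[R]^s M) ⊗[R] ExteriorAlgebra R N} (hx : x ∈ qiTerm R M N s l) :
    qiMap φ ψ s x ∈ qiTerm R M' N' s l := by
  rw [qiTerm_eq_span] at hx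
  induction hx using Submodule.span_induction with
  | mem x h =>
    obtain ⟨t, ht, ω, hω, rfl⟩ := h
    exact tmul_mem_qiTerm (powMap_mem_symTensor φ s ht) (map_mem_exteriorPower ψ hω)
  | zero => simp
  | add x y _ _ hx hy => rw [map_add]; exact add_mem hx hy
  | smul r x _ hx => rw [map_smul]; exact Submodule.smul_mem _ r hx

end Functoriality

section Contraction

variable {R}
variable {N : Type*} [AddCommGroup N] [Module R N]

/-- Contraction of the exterior algebra by a linear form. -/
def contr (d : Module.Dual R N) : ExteriorAlgebra R N →ₗ[R] ExteriorAlgebra R N :=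
  CliffordAlgebra.contractLeft d

theorem contr_ι_mul (d : Module.Dual R N) (x : N) (ω : ExteriorAlgebra R N) :
    contr d (ExteriorAlgebra.ι R x * ω) = d x • ω - ExteriorAlgebra.ι R x * contr d ω :=
  CliffordAlgebra.contractLeft_ι_mul _ x ω

theorem contr_algebraMap (d : Module.Dual R N) (r : R) :
    contr d (algebraMap R (ExteriorAlgebra R N) r) = 0 :=
  CliffordAlgebra.contractLeft_algebraMap _ d r

theorem mem_exteriorPower_zero {ω : ExteriorAlgebra R N} (hω : ω ∈ ⋀[R]^0 N) :
    ∃ r : R, algebraMap R (ExteriorAlgebra R N) r = ω := by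
  have h : ω ∈ (LinearMap.range (ExteriorAlgebra.ι R : N →ₗ[R] _)) ^ 0 := hω
  rw [pow_zero] at h
  exact Submodule.mem_one.mp h

theorem contr_eq_zero_of_mem {d : Module.Dual R N} {ω : ExteriorAlgebra R N}
    (hω : ω ∈ ⋀[R]^0 N) : contr d ω = 0 := by
  obtain ⟨r, rfl⟩ := mem_exteriorPower_zero hω
  exact contr_algebraMap d r

theorem ι_mul_mem {l : ℕ} (x : N) {ω : ExteriorAlgebra R N} (hω : ω ∈ ⋀[R]^l N) :
    ExteriorAlgebra.ι R x * ω ∈ ⋀[R]^(l + 1) N := by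
  change _ ∈ (LinearMap.range (ExteriorAlgebra.ι R : N →ₗ[R] _)) ^ (l + 1)
  rw [pow_succ']
  exact Submodule.mul_mem_mul ⟨x, rfl⟩ hω

/-- Elements of positive degree are sums of products `ι x * ω`. -/
theorem exteriorPower_succ_induction {l : ℕ} {p : ExteriorAlgebra R N → Prop}
    (hp : ∀ x, ∀ ω ∈ ⋀[R]^l N, p (ExteriorAlgebra.ι R x * ω))
    (hadd : ∀ a b, p a → p b → p (a + b)) {ω : ExteriorAlgebra R N}
    (hω : ω ∈ ⋀[R]^(l + 1) N) : p ω := by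
  have h : ω ∈ (LinearMap.range (ExteriorAlgebra.ι R : N →ₗ[R] _)) ^ (l + 1) := hω
  rw [pow_succ'] at h
  induction h using Submodule.mul_induction_on' with
  | mem_mul_mem m hm n hn =>
    obtain ⟨x, rfl⟩ := hm
    exact hp x n hn
  | add a ha b hb h₁ h₂ =>
    exact hadd a b (h₁ (by change _ ∈ _ ^ _; rw [pow_succ']; exact ha))
      (h₂ (by change _ ∈ _ ^ _; rw [pow_succ']; exact hb))

theorem contr_mem (d : Module.Dual R N) {l : ℕ} {ω : ExteriorAlgebra R N}
    (hω : ω ∈ ⋀[R]^(l + 1) N) : contr d ω ∈ ⋀[R]^l N := by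
  induction l generalizing ω with
  | zero =>
    refine exteriorPower_succ_induction (p := fun ω => contr d ω ∈ ⋀[R]^0 N)
      (fun x ω hω => ?_) (fun a b ha hb => ?_) hω
    · rw [contr_ι_mul, contr_eq_zero_of_mem hω, mul_zero, sub_zero]
      exact Submodule.smul_mem _ _ hω
    · rw [map_add]
      exact add_mem ha hb
  | succ l ih =>
    refine exteriorPower_succ_induction (p := fun ω => contr d ω ∈ ⋀[R]^(l + 1) N)
      (fun x ω hω => ?_) (fun a b ha hb => ?_) hω
    · rw [contr_ι_mul]
      exact sub_mem (Submodule.smul_mem _ _ hω) (ι_mul_mem x (ih hω))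
    · rw [map_add]
      exact add_mem ha hb

/-- The endomorphism of `ΛN` induced by `x ↦ x - d x • c`. -/
theorem map_id_sub_smulRight (d : Module.Dual R N) (c : N) (ω : ExteriorAlgebra R N) :
    ExteriorAlgebra.map (LinearMap.id - d.smulRight c) ω =
      ω - ExteriorAlgebra.ι R c * contr d ω := by
  induction ω using CliffordAlgebra.left_induction with
  | algebraMap r =>
    erw [AlgHom.commutes, contr_algebraMap]
    simp
  | add x y hx hy =>
    simp only [map_add, hx, hy, mul_add]
    exact sub_add_sub_comm _ _ _ _
  | ι_mul ω x ih =>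
    change ExteriorAlgebra.map _ (ExteriorAlgebra.ι R x * ω) =
      ExteriorAlgebra.ι R x * ω - _ * contr d (ExteriorAlgebra.ι R x * ω)
    have hs : ∀ η : ExteriorAlgebra R N,
        ExteriorAlgebra.ι R c * (ExteriorAlgebra.ι R c * η) = 0 := fun η => by
      rw [← mul_assoc, ExteriorAlgebra.ι_sq_zero, zero_mul]
    have hc : ∀ η : ExteriorAlgebra R N, ExteriorAlgebra.ι R x * (ExteriorAlgebra.ι R c * η) =
        - (ExteriorAlgebra.ι R c * (ExteriorAlgebra.ι R x * η)) := fun η => by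
      rw [← mul_assoc, ← mul_assoc, ← neg_mul, eq_neg_of_add_eq_zero_left
        (ExteriorAlgebra.ι_add_mul_swap x c)]
    rw [map_mul, ih, ExteriorAlgebra.map_apply_ι, contr_ι_mul]
    simp only [LinearMap.sub_apply, LinearMap.id_apply, LinearMap.smulRight_apply, map_sub,
      map_smul, sub_mul, mul_sub, smul_mul_assoc, hs, hc, mul_smul_comm, smul_zero, sub_zero]
    rw [sub_neg_eq_add]
    exact sub_add _ _ _

/-- A form of positive degree killed by all contractions against a basis vanishes. -/
theorem eq_zero_of_contr_eq_zero {β : Type*} [Fintype β] (c : Module.Basis β R N)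
    {l : ℕ} {ω : ExteriorAlgebra R N} (hω : ω ∈ ⋀[R]^(l + 1) N)
    (h : ∀ j, contr (c.coord j) ω = 0) : ω = 0 := by
  classical
  have key : ∀ T : Finset β, ExteriorAlgebra.map
      (LinearMap.id - ∑ j ∈ T, (c.coord j).smulRight (c j)) ω = ω := by
    intro T
    induction T using Finset.induction_on with
    | empty => simp [ExteriorAlgebra.map_id]
    | insert j T hj ih =>
      have hcomp : (LinearMap.id - ∑ k ∈ insert j T, (c.coord k).smulRight (c k)) =
          (LinearMap.id - ∑ k ∈ T, (c.coord k).smulRight (c k)) ∘ₗ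
            (LinearMap.id - (c.coord j).smulRight (c j)) := by
        have h0 : ∑ k ∈ T, (Finsupp.single j (1 : R) k) • c k = 0 :=
          Finset.sum_eq_zero fun k hk => by
            rw [Finsupp.single_eq_of_ne (by rintro rfl; exact hj hk), zero_smul]
        ext x
        simp only [Finset.sum_insert hj, LinearMap.sub_apply, LinearMap.add_apply,
          LinearMap.id_apply, LinearMap.comp_apply, LinearMap.sum_apply,
          LinearMap.smulRight_apply, map_sub, map_smul, Module.Basis.coord_apply,
          Module.Basis.repr_self, h0]
        rw [sub_zero, add_comm, sub_sub]
      rw [hcomp, ← ExteriorAlgebra.map_comp_map, AlgHom.comp_apply, map_id_sub_smulRight, h j,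
        mul_zero, sub_zero, ih]
  have hzero : (LinearMap.id - ∑ j, (c.coord j).smulRight (c j) : N →ₗ[R] N) = 0 := by
    ext x
    simp [LinearMap.sum_apply, c.sum_repr]
  rw [← key Finset.univ, hzero]
  refine exteriorPower_succ_induction
    (p := fun ω => ExteriorAlgebra.map (0 : N →ₗ[R] N) ω = 0) (fun x ω _ => ?_)
    (fun a b ha hb => ?_) hω
  · simp
  · rw [map_add, ha, hb, add_zero]

end Contraction

section Homotopy

variable {R}
variable {ι W : Type*} [AddCommGroup W] [Module R W]

/-- The Koszul differential `(d g) m = ∑ i, e i (g (i ::ₘ m))` on functions of multisets. -/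
def koszul [Fintype ι] (e : ι → W →ₗ[R] W) : (Multiset ι → W) →ₗ[R] (Multiset ι → W) where
  toFun g m := ∑ i, e i (g (i ::ₘ m))
  map_add' g h := by
    ext m
    simp [Finset.sum_add_distrib]
  map_smul' r g := by
    ext m
    simp [Finset.smul_sum]

theorem koszul_apply [Fintype ι] (e : ι → W →ₗ[R] W) (g : Multiset ι → W) (m : Multiset ι) :
    koszul e g m = ∑ i, e i (g (i ::ₘ m)) :=
  rfl

theorem koszul_koszul [Fintype ι] [DecidableEq ι] (e : ι → W →ₗ[R] W)
    (hsq : ∀ i w, e i (e i w) = 0)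
    (hanti : ∀ i k w, e i (e k w) = -e k (e i w)) (g : Multiset ι → W) :
    koszul e (koszul e g) = 0 := by
  ext m
  simp only [koszul_apply, map_sum, Pi.zero_apply]
  rw [← Finset.sum_product']
  refine Finset.sum_involution (fun p _ => p.swap) ?_ ?_ ?_ ?_
  · rintro ⟨i, k⟩ -
    simp only [Prod.swap]
    rw [hanti i k, Multiset.cons_swap]
    exact neg_add_cancel _
  · rintro ⟨i, k⟩ - h heq
    obtain rfl : k = i := congrArg Prod.fst heq
    exact h (hsq _ _)
  · simp
  · simp

/-- The contracting homotopy attached to the index `j`. -/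
def homotopy [DecidableEq ι] (D : ι → W →ₗ[R] W) (j : ι) (g : Multiset ι → W)
    (m : Multiset ι) : W :=
  if j ∈ m then D j (g (m.erase j)) else 0

theorem koszul_homotopy [Fintype ι] [DecidableEq ι] (e D : ι → W →ₗ[R] W) (j : ι)
    (hDe : ∀ i w, D j (e i w) = (if i = j then w else 0) - e i (D j w))
    (g : Multiset ι → W) (m : Multiset ι) :
    koszul e (homotopy D j g) m =
      g m - if j ∈ m then D j (koszul e g (m.erase j)) else D j (e j (g m)) := by
  have hDe' : ∀ i w, e i (D j w) = (if i = j then w else 0) - D j (e i w) := fun i w => by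
    rw [hDe, sub_sub_cancel]
  simp only [koszul_apply, homotopy]
  split_ifs with hj
  · have : ∀ i, (i ::ₘ m).erase j = i ::ₘ m.erase j := fun i => by
      by_cases hij : i = j
      · rw [hij, Multiset.erase_cons_head, Multiset.cons_erase hj]
      · exact Multiset.erase_cons_tail _ hij
    simp only [Multiset.mem_cons, hj, or_true, if_true, this, hDe', Finset.sum_sub_distrib,
      Finset.sum_ite_eq', Finset.mem_univ, map_sum, Multiset.cons_erase hj]
  · rw [Finset.sum_eq_single j]
    · simp [hDe']
    · intro i _ hij
      simp [hj, Ne.symm hij]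
    · simp

theorem exists_koszul_add [Fintype ι] [DecidableEq ι] (e D : ι → W →ₗ[R] W) (γ : Finset ι)
    (hsq : ∀ i w, e i (e i w) = 0)
    (hanti : ∀ i k w, e i (e k w) = -e k (e i w))
    (hDsq : ∀ i w, D i (D i w) = 0)
    (hDanti : ∀ i k w, D i (D k w) = -D k (D i w))
    (hDe : ∀ j ∈ γ, ∀ i w, D j (e i w) = (if i = j then w else 0) - e i (D j w))
    (V : ℕ → Submodule R W) (hV : ∀ i l w, w ∈ V l → e i w ∈ V (l + 1))
    (hVD : ∀ i l w, w ∈ V (l + 1) → D i w ∈ V l) (l : ℕ)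
    (g : Multiset ι → W) (hg : ∀ m, g m ∈ V (l + 1)) (hdg : koszul e g = 0) :
    ∃ h g' : Multiset ι → W, (∀ m, h m ∈ V l) ∧ (∀ m, g' m ∈ V (l + 1)) ∧ koszul e g' = 0 ∧
      (∀ j ∈ γ, ∀ m, D j (g' m) = 0) ∧ g = koszul e h + g' := by
  induction γ using Finset.induction_on with
  | empty => exact ⟨0, g, fun m => zero_mem _, hg, hdg, by simp, by simp⟩
  | insert j γ hj ih =>
    obtain ⟨h, g', hh, hg', hdg', hDg', rfl⟩ :=
      ih fun k hk => hDe k (Finset.mem_insert_of_mem hk)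
    have hDej := hDe j (Finset.mem_insert_self j γ)
    have heq : g' = koszul e (homotopy D j g') +
        fun m => if j ∈ m then 0 else D j (e j (g' m)) := by
      ext m
      rw [Pi.add_apply, koszul_homotopy e D j hDej, hdg']
      simp
    refine ⟨h + homotopy D j g', fun m => if j ∈ m then 0 else D j (e j (g' m)),
      fun m => add_mem (hh m) ?_, fun m => ?_, ?_, fun k hk m => ?_, ?_⟩
    · unfold homotopy
      split_ifs
      · exact hVD _ _ _ (hg' _)
      · exact zero_mem _
    · dsimp only
      split_ifs
      · exact zero_mem _
      · exact hVD _ _ _ (hV _ _ _ (hg' _))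
    · have := congrArg (koszul e) heq
      rwa [map_add, koszul_koszul e hsq hanti, zero_add, hdg', eq_comm] at this
    · dsimp only
      split_ifs
      · exact map_zero _
      · rcases Finset.mem_insert.mp hk with rfl | hk'
        · exact hDsq _ _
        · have hne : j ≠ k := by
            rintro rfl
            exact hj hk'
          rw [hDanti, hDe k hk, if_neg hne, hDg' k hk']
          simp
    · rw [map_add, add_assoc, ← heq]

end Homotopy

section FreeCase

variable {R}
variable {ι M W : Type*} [AddCommGroup M] [Module R M] [AddCommGroup W] [Module R W]

theorem exists_map_univ_eq {s : ℕ} {m : Multiset ι} (hm : m.card = s) :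
    ∃ p : Fin s → ι, Finset.univ.val.map p = m := by
  subst hm
  obtain ⟨l, rfl⟩ := Quot.exists_rep m
  exact ⟨l.get, (Fin.univ_val_map l.get).trans (congrArg _ (List.ofFn_get l))⟩

theorem exists_perm_of_map_univ_eq {s : ℕ} {p q : Fin s → ι}
    (h : Finset.univ.val.map p = Finset.univ.val.map q) :
    ∃ σ : Equiv.Perm (Fin s), p ∘ σ = q := by
  classical
  have hc : ∀ a, Nonempty ({i // q i = a} ≃ {i // p i = a}) := fun a => by
    refine ⟨Fintype.equivOfCardEq ?_⟩
    have := congrArg (Multiset.count a) h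
    simp only [Multiset.count_map, eq_comm (a := a)] at this
    rw [Fintype.card_subtype, Fintype.card_subtype]
    exact this.symm
  let e := fun a => (hc a).some
  exact ⟨Equiv.ofFiberEquiv e, funext fun i => Equiv.ofFiberEquiv_map e i⟩

theorem piTensorProduct_repr_reindex (b : Module.Basis ι R M) {s : ℕ}
    (σ : Equiv.Perm (Fin s)) (t : ⨂[R]^s M) (p : Fin s → ι) :
    (Basis.piTensorProduct fun _ : Fin s => b).repr
      (PiTensorProduct.reindex R (fun _ => M) σ t) p =
    (Basis.piTensorProduct fun _ : Fin s => b).repr t (p ∘ σ) := by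
  induction t using PiTensorProduct.induction_on with
  | smul_tprod r f =>
    rw [map_smul, PiTensorProduct.reindex_tprod, map_smul, map_smul, Finsupp.smul_apply,
      Finsupp.smul_apply, Basis.piTensorProduct_repr_tprod_apply,
      Basis.piTensorProduct_repr_tprod_apply, ← Equiv.prod_comp σ]
    refine congrArg _ (Finset.prod_congr rfl fun i _ => ?_)
    exact congrArg (fun z => b.repr (f z) (p (σ i))) (σ.symm_apply_apply i)
  | add x y hx hy => simp only [map_add, Finsupp.add_apply, hx, hy]

variable [Fintype ι]

/-- The tensor `∑ p, (b_{p 0} ⊗ ⋯ ⊗ b_{p (s-1)}) ⊗ g {p 0, …, p (s-1)}`. -/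
def monoSum (b : Module.Basis ι R M) (s : ℕ) : (Multiset ι → W) →ₗ[R] (⨂[R]^s M) ⊗[R] W where
  toFun g := ∑ p : Fin s → ι,
    PiTensorProduct.tprod R (fun i => b (p i)) ⊗ₜ[R] g (Finset.univ.val.map p)
  map_add' g h := by simp [TensorProduct.tmul_add, Finset.sum_add_distrib]
  map_smul' r g := by simp [Finset.smul_sum]

theorem monoSum_apply (b : Module.Basis ι R M) (s : ℕ) (g : Multiset ι → W) :
    monoSum b s g = ∑ p : Fin s → ι,
      PiTensorProduct.tprod R (fun i => b (p i)) ⊗ₜ[R] g (Finset.univ.val.map p) :=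
  rfl

theorem monoSum_congr (b : Module.Basis ι R M) (s : ℕ) {g h : Multiset ι → W}
    (hgh : ∀ m, m.card = s → g m = h m) : monoSum b s g = monoSum b s h := by
  refine Finset.sum_congr rfl fun p _ => ?_
  rw [hgh _ (by simp)]

theorem eq_zero_of_monoSum_eq_zero (b : Module.Basis ι R M) {s : ℕ} {g : Multiset ι → W}
    (hg : monoSum b s g = 0) {m : Multiset ι} (hm : m.card = s) : g m = 0 := by
  classical
  obtain ⟨p, rfl⟩ := exists_map_univ_eq hm
  have h := congrArg (fun x =>
    TensorProduct.equivFinsuppOfBasisLeft (Basis.piTensorProduct fun _ : Fin s => b) x p) hg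
  simp only [monoSum_apply, map_sum, map_zero, Finsupp.finsetSum_apply,
    ← Basis.piTensorProduct_apply, TensorProduct.equivFinsuppOfBasisLeft_apply_tmul_apply,
    Module.Basis.repr_self, Finsupp.single_apply, ite_smul, one_smul, zero_smul,
    Finset.sum_ite_eq', Finset.mem_univ, if_true] at h
  exact h

theorem exists_monoSum_eq_tmul (b : Module.Basis ι R M) {s : ℕ} {t : ⨂[R]^s M}
    (ht : t ∈ SymTensor R M s) :
    ∃ c : Multiset ι → R, ∀ w : W, monoSum b s (fun m => c m • w) = t ⊗ₜ[R] w := by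
  classical
  let B := Basis.piTensorProduct fun _ : Fin s => b
  refine ⟨fun m => if h : ∃ p : Fin s → ι, Finset.univ.val.map p = m then
    B.repr t h.choose else 0, fun w => ?_⟩
  have hp : ∀ p : Fin s → ι, (if h : ∃ q : Fin s → ι, Finset.univ.val.map q =
      Finset.univ.val.map p then B.repr t h.choose else 0) = B.repr t p := fun p => by
    have h : ∃ q : Fin s → ι, Finset.univ.val.map q = Finset.univ.val.map p := ⟨p, rfl⟩
    rw [dif_pos h]
    obtain ⟨σ, hσ⟩ := exists_perm_of_map_univ_eq h.choose_spec
    have := piTensorProduct_repr_reindex b σ t h.choose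
    rw [ht σ, hσ] at this
    exact this
  simp only [monoSum_apply, hp, ← TensorProduct.smul_tmul, ← TensorProduct.sum_tmul]
  congr 1
  simp only [← Basis.piTensorProduct_apply]
  exact B.sum_repr t

variable {N : Type*} [AddCommGroup N] [Module R N]

theorem exists_monoSum_eq (b : Module.Basis ι R M) {s l : ℕ}
    {x : (⨂[R]^s M) ⊗[R] ExteriorAlgebra R N} (hx : x ∈ qiTerm R M N s l) :
    ∃ g : Multiset ι → ExteriorAlgebra R N, (∀ m, g m ∈ ⋀[R]^l N) ∧ monoSum b s g = x := by
  rw [qiTerm_eq_span] at hx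
  induction hx using Submodule.span_induction with
  | mem x h =>
    obtain ⟨t, ht, ω, hω, rfl⟩ := h
    obtain ⟨c, hc⟩ := exists_monoSum_eq_tmul (W := ExteriorAlgebra R N) b ht
    exact ⟨_, fun m => Submodule.smul_mem _ _ hω, hc ω⟩
  | zero => exact ⟨0, fun m => zero_mem _, map_zero _⟩
  | add x y _ _ hx hy =>
    obtain ⟨g, hg, rfl⟩ := hx
    obtain ⟨h, hh, rfl⟩ := hy
    exact ⟨g + h, fun m => add_mem (hg m) (hh m), map_add _ _ _⟩
  | smul r x _ hx =>
    obtain ⟨g, hg, rfl⟩ := hx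
    exact ⟨r • g, fun m => Submodule.smul_mem _ _ (hg m), map_smul _ _ _⟩

theorem monoSum_mem_qiTerm (b : Module.Basis ι R M) {s l : ℕ}
    {g : Multiset ι → ExteriorAlgebra R N} (hg : ∀ m, g m ∈ ⋀[R]^l N) :
    monoSum b s g ∈ qiTerm R M N s l := by
  classical
  rw [monoSum_apply, ← Finset.sum_fiberwise_of_maps_to
    (t := Finset.univ.image fun p : Fin s → ι => Finset.univ.val.map p)
    (g := fun p => Finset.univ.val.map p)
    (fun p _ => Finset.mem_image_of_mem _ (Finset.mem_univ p))]
  refine sum_mem fun m _ => ?_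
  have h : ∑ p : Fin s → ι with Finset.univ.val.map p = m,
      PiTensorProduct.tprod R (fun i => b (p i)) ⊗ₜ[R] g (Finset.univ.val.map p) =
      (∑ p : Fin s → ι with Finset.univ.val.map p = m,
        PiTensorProduct.tprod R (fun i => b (p i))) ⊗ₜ[R] g m := by
    rw [TensorProduct.sum_tmul]
    refine Finset.sum_congr rfl fun p hp => ?_
    rw [(Finset.mem_filter.mp hp).2]
  rw [h]
  refine tmul_mem_qiTerm (fun σ => ?_) (hg m)
  rw [map_sum]
  refine Finset.sum_equiv (Equiv.arrowCongr σ (Equiv.refl ι)) (fun p => ?_) (fun p _ => ?_)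
  · have : Finset.univ.val.map (Equiv.arrowCongr σ (Equiv.refl ι) p) = Finset.univ.val.map p := by
      have h2 := congrArg Finset.val (Finset.map_univ_equiv σ.symm)
      rw [Finset.map_val] at h2
      conv_rhs => rw [← h2, Multiset.map_map]
      rfl
    simp only [Finset.mem_filter, Finset.mem_univ, true_and, this]
  · rw [PiTensorProduct.reindex_tprod]
    rfl

/-- Left exterior multiplication by the image of a basis vector. -/
def wedgeMul (b : Module.Basis ι R M) (v : M →ₗ[R] N) (i : ι) :
    ExteriorAlgebra R N →ₗ[R] ExteriorAlgebra R N :=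
  LinearMap.mulLeft R (ExteriorAlgebra.ι R (v (b i)))

theorem qiDiff_monoSum (b : Module.Basis ι R M) (v : M →ₗ[R] N) (s : ℕ)
    (g : Multiset ι → ExteriorAlgebra R N) :
    qiDiff v s (monoSum b (s + 1) g) = monoSum b s (koszul (wedgeMul b v) g) := by
  simp only [monoSum_apply, map_sum, qiDiff_tprod_tmul, koszul_apply, TensorProduct.tmul_sum]
  rw [← Equiv.sum_comp (Fin.snocEquiv fun _ => ι), Fintype.sum_prod_type_right]
  refine Finset.sum_congr rfl fun p _ => Finset.sum_congr rfl fun i _ => ?_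
  have : Finset.univ.val.map (Fin.snocEquiv (fun _ => ι) (i, p)) =
      i ::ₘ Finset.univ.val.map p := by
    rw [Fin.univ_castSuccEmb]
    simp [Fin.snocEquiv]
  rw [this]
  simp [Fin.snocEquiv, wedgeMul]

end FreeCase

section SplitFreeCase

variable {R}
variable {ι M N : Type*} [AddCommGroup M] [Module R M] [AddCommGroup N] [Module R N]

theorem wedgeMul_apply (b : Module.Basis ι R M) (v : M →ₗ[R] N) (i : ι)
    (ω : ExteriorAlgebra R N) :
    wedgeMul b v i ω = ExteriorAlgebra.ι R (v (b i)) * ω :=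
  rfl

theorem wedgeMul_self (b : Module.Basis ι R M) (v : M →ₗ[R] N) (i : ι)
    (ω : ExteriorAlgebra R N) : wedgeMul b v i (wedgeMul b v i ω) = 0 := by
  rw [wedgeMul_apply, wedgeMul_apply, ← mul_assoc, ExteriorAlgebra.ι_sq_zero, zero_mul]

theorem wedgeMul_swap (b : Module.Basis ι R M) (v : M →ₗ[R] N) (i k : ι)
    (ω : ExteriorAlgebra R N) :
    wedgeMul b v i (wedgeMul b v k ω) = -wedgeMul b v k (wedgeMul b v i ω) := by
  simp only [wedgeMul_apply]
  rw [← mul_assoc, ← mul_assoc, ← neg_mul, eq_neg_of_add_eq_zero_left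
    (ExteriorAlgebra.ι_add_mul_swap _ _)]

variable [Fintype ι]

theorem qiDiff_mem_of_basis (b : Module.Basis ι R M) (v : M →ₗ[R] N) {s l : ℕ}
    {x : (⨂[R]^(s + 1) M) ⊗[R] ExteriorAlgebra R N} (hx : x ∈ qiTerm R M N (s + 1) l) :
    qiDiff v s x ∈ qiTerm R M N s (l + 1) := by
  obtain ⟨g, hg, rfl⟩ := exists_monoSum_eq b hx
  rw [qiDiff_monoSum]
  exact monoSum_mem_qiTerm b fun m => sum_mem fun i _ => ι_mul_mem _ (hg _)

theorem qiDiff_qiDiff_of_basis (b : Module.Basis ι R M) (v : M →ₗ[R] N) {s l : ℕ}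
    {x : (⨂[R]^(s + 2) M) ⊗[R] ExteriorAlgebra R N} (hx : x ∈ qiTerm R M N (s + 2) l) :
    qiDiff v s (qiDiff v (s + 1) x) = 0 := by
  classical
  obtain ⟨g, hg, rfl⟩ := exists_monoSum_eq b hx
  rw [qiDiff_monoSum, qiDiff_monoSum,
    koszul_koszul _ (wedgeMul_self b v) (wedgeMul_swap b v), map_zero]

variable {α β : Type*}

theorem contr_wedgeMul [DecidableEq α] [DecidableEq β] (b : Module.Basis (α ⊕ β) R M)
    (c : Module.Basis β R N) (v : M →ₗ[R] N)
    (hl : ∀ i, v (b (Sum.inl i)) = 0) (hr : ∀ j, v (b (Sum.inr j)) = c j) (j : β) (i : α ⊕ β)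
    (ω : ExteriorAlgebra R N) :
    contr (c.coord j) (wedgeMul b v i ω) =
      (if i = Sum.inr j then ω else 0) - wedgeMul b v i (contr (c.coord j) ω) := by
  rw [wedgeMul_apply, contr_ι_mul, wedgeMul_apply]
  rcases i with i | k
  · simp [hl]
  · rw [hr]
    simp [Finsupp.single_apply]

variable [Fintype α] [Fintype β]

theorem exists_qiDiff_eq_of_basis (b : Module.Basis (α ⊕ β) R M)
    (c : Module.Basis β R N) (v : M →ₗ[R] N)
    (hl : ∀ i, v (b (Sum.inl i)) = 0) (hr : ∀ j, v (b (Sum.inr j)) = c j) {s l : ℕ}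
    {x : (⨂[R]^(s + 1) M) ⊗[R] ExteriorAlgebra R N} (hx : x ∈ qiTerm R M N (s + 1) (l + 1))
    (hdx : qiDiff v s x = 0) :
    ∃ y ∈ qiTerm R M N (s + 2) l, qiDiff v (s + 1) y = x := by
  classical
  obtain ⟨g₀, hg₀, rfl⟩ := exists_monoSum_eq b hx
  let g : Multiset (α ⊕ β) → ExteriorAlgebra R N := fun m => if m.card = s + 1 then g₀ m else 0
  have hg : ∀ m, g m ∈ ⋀[R]^(l + 1) N := fun m => by
    simp only [g]
    split_ifs
    exacts [hg₀ m, zero_mem _]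
  have hgg₀ : monoSum b (s + 1) g₀ = monoSum b (s + 1) g :=
    monoSum_congr b _ fun m hm => (if_pos hm).symm
  rw [hgg₀, qiDiff_monoSum] at hdx
  have hdg : koszul (wedgeMul b v) g = 0 := by
    ext1 m
    by_cases hm : m.card = s
    · exact eq_zero_of_monoSum_eq_zero b hdx hm
    · exact Finset.sum_eq_zero fun i _ => by
        rw [show g (i ::ₘ m) = 0 from if_neg (by simpa using hm), map_zero]
  let D : α ⊕ β → ExteriorAlgebra R N →ₗ[R] ExteriorAlgebra R N :=
    Sum.elim (fun _ => 0) fun j => contr (c.coord j)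
  obtain ⟨h, g', hh, hg', -, hDg', hgh⟩ := exists_koszul_add (wedgeMul b v) D
    (Finset.univ.image Sum.inr) (wedgeMul_self b v) (wedgeMul_swap b v)
    (by
      rintro (i | j) w
      · rfl
      · exact CliffordAlgebra.contractLeft_contractLeft _ w)
    (by
      rintro (i | j) (i' | j') w
      · simp [D]
      · simp [D]
      · simp [D]
      · exact CliffordAlgebra.contractLeft_comm _ _ w)
    (by
      intro k hk i w
      obtain ⟨j, -, rfl⟩ := Finset.mem_image.mp hk
      exact contr_wedgeMul b c v hl hr j i w)
    (fun l => ⋀[R]^l N) (fun i l w hw => ι_mul_mem _ hw)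
    (by
      rintro (i | j) l w hw
      · exact zero_mem _
      · exact contr_mem _ hw)
    l g hg hdg
  have hg'0 : g' = 0 := by
    ext1 m
    exact eq_zero_of_contr_eq_zero c (hg' m) fun j =>
      hDg' (Sum.inr j) (Finset.mem_image_of_mem _ (Finset.mem_univ j)) m
  refine ⟨monoSum b (s + 2) h, monoSum_mem_qiTerm b hh, ?_⟩
  rw [qiDiff_monoSum, hgg₀, hgh, hg'0, add_zero]

theorem qiMap_eq_self_of_basis (b : Module.Basis (α ⊕ β) R M)
    (c : Module.Basis β R N) (v : M →ₗ[R] N)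
    (hl : ∀ i, v (b (Sum.inl i)) = 0) (hr : ∀ j, v (b (Sum.inr j)) = c j)
    (φ : M →ₗ[R] M) (hφ : ∀ i, φ (b (Sum.inl i)) = b (Sum.inl i)) {s : ℕ}
    {x : (⨂[R]^(s + 1) M) ⊗[R] ExteriorAlgebra R N} (hx : x ∈ qiTerm R M N (s + 1) 0)
    (hdx : qiDiff v s x = 0) :
    qiMap φ LinearMap.id (s + 1) x = x := by
  classical
  obtain ⟨g, hg, rfl⟩ := exists_monoSum_eq b hx
  rw [qiDiff_monoSum] at hdx
  have hg0 : ∀ j : β, ∀ m, m.card = s → g (Sum.inr j ::ₘ m) = 0 := fun j m hm => by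
    have h := congrArg (contr (c.coord j)) (eq_zero_of_monoSum_eq_zero b hdx hm)
    simpa [koszul_apply, contr_wedgeMul b c v hl hr, contr_eq_zero_of_mem (hg _)] using h
  rw [monoSum_apply, map_sum]
  refine Finset.sum_congr rfl fun p _ => ?_
  by_cases hp : ∃ k j, p k = Sum.inr j
  · obtain ⟨k, j, hk⟩ := hp
    have hmem : Sum.inr j ∈ Finset.univ.val.map p :=
      Multiset.mem_map.mpr ⟨k, Finset.mem_univ k, hk⟩
    rw [← Multiset.cons_erase hmem, hg0 j _ (by rw [Multiset.card_erase_of_mem hmem]; simp)]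
    simp
  · push Not at hp
    have hp' : ∀ k, φ (b (p k)) = b (p k) := fun k => by
      rcases h : p k with i | j
      · exact hφ i
      · exact absurd h (hp k j)
    rw [qiMap_tmul, powMap_tprod, ExteriorAlgebra.map_id]
    simp only [hp', AlgHom.id_apply]

end SplitFreeCase

section Kill

variable {R}
variable {A A' B B' Q M P N : Type*}
  [AddCommGroup A] [AddCommGroup A'] [AddCommGroup B] [AddCommGroup B']
  [AddCommGroup Q] [AddCommGroup M] [AddCommGroup P] [AddCommGroup N]
  [Module R A] [Module R A'] [Module R B] [Module R B']
  [Module R Q] [Module R M] [Module R P] [Module R N]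

/-- Induction principle for the kernel of a tensor product of surjections. -/
theorem map_eq_zero_induction {f : A →ₗ[R] A'} {g : B →ₗ[R] B'} (hf : Function.Surjective f)
    (hg : Function.Surjective g) {p : A ⊗[R] B → Prop}
    (hl : ∀ a b, f a = 0 → p (a ⊗ₜ b)) (hr : ∀ a b, g b = 0 → p (a ⊗ₜ b))
    (hadd : ∀ x y, p x → p y → p (x + y)) {z : A ⊗[R] B} (hz : TensorProduct.map f g z = 0) :
    p z := by
  have h0 : p 0 := by simpa using hl 0 0 (map_zero f)
  have hz' : z ∈ LinearMap.ker (TensorProduct.map f g) := hz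
  rw [TensorProduct.map_ker (LinearMap.exact_subtype_ker_map f) hf
    (LinearMap.exact_subtype_ker_map g) hg] at hz'
  have hL : ∀ x, p (LinearMap.lTensor A (LinearMap.ker g).subtype x) := fun x => by
    induction x using TensorProduct.induction_on with
    | zero => simpa using h0
    | tmul a b => exact hr _ _ b.2
    | add x y hx hy =>
      rw [map_add]
      exact hadd _ _ hx hy
  have hR : ∀ x, p (LinearMap.rTensor B (LinearMap.ker f).subtype x) := fun x => by
    induction x using TensorProduct.induction_on with
    | zero => simpa using h0
    | tmul a b => exact hl _ _ a.2
    | add x y hx hy =>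
      rw [map_add]
      exact hadd _ _ hx hy
  obtain ⟨_, ⟨x, rfl⟩, _, ⟨y, rfl⟩, rfl⟩ := Submodule.mem_sup.mp hz'
  exact hadd _ _ (hL x) (hR y)

theorem powMap_zero_injective (π : Q →ₗ[R] M) : Function.Injective (powMap π 0) := by
  have h : ∀ z : ⨂[R]^0 Q, PiTensorProduct.isEmptyEquiv (R := R) (s := fun _ : Fin 0 => M) (Fin 0)
      (powMap π 0 z) = PiTensorProduct.isEmptyEquiv (Fin 0) z := fun z => by
    induction z using PiTensorProduct.induction_on with
    | smul_tprod r f => simp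
    | add x y hx hy => simp only [map_add, hx, hy]
  intro x y hxy
  apply (PiTensorProduct.isEmptyEquiv (R := R) (Fin 0)).injective
  rw [← h, ← h, hxy]

theorem exists_finset_powMap_eq_zero {π : Q →ₗ[R] M} (hπ : Function.Surjective π) {s : ℕ}
    {z : ⨂[R]^s Q} (hz : powMap π s z = 0) :
    ∃ K : Finset Q, (∀ k ∈ K, π k = 0) ∧
      ∀ φ : Q →ₗ[R] Q, (∀ k ∈ K, φ k = 0) → powMap φ s z = 0 := by
  classical
  induction s with
  | zero =>
    obtain rfl : z = 0 := powMap_zero_injective π (by rw [hz, map_zero])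
    exact ⟨∅, by simp, fun φ _ => map_zero _⟩
  | succ s ih =>
    have hz' : TensorProduct.map (powMap π s) π (splitPow R Q s z) = 0 := by
      rw [← splitPow_powMap, hz, map_zero]
    suffices h : ∃ K : Finset Q, (∀ k ∈ K, π k = 0) ∧ ∀ φ : Q →ₗ[R] Q, (∀ k ∈ K, φ k = 0) →
        TensorProduct.map (powMap φ s) φ (splitPow R Q s z) = 0 by
      obtain ⟨K, hK, h⟩ := h
      refine ⟨K, hK, fun φ hφ => (splitPow R Q s).injective ?_⟩
      rw [splitPow_powMap, h φ hφ, map_zero]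
    refine map_eq_zero_induction (powMap_surjective hπ s) hπ (p := fun w => ∃ K : Finset Q,
      (∀ k ∈ K, π k = 0) ∧ ∀ φ : Q →ₗ[R] Q, (∀ k ∈ K, φ k = 0) →
        TensorProduct.map (powMap φ s) φ w = 0) ?_ ?_ ?_ hz'
    · intro a b ha
      obtain ⟨K, hK, h⟩ := ih ha
      exact ⟨K, hK, fun φ hφ => by rw [TensorProduct.map_tmul, h φ hφ, TensorProduct.zero_tmul]⟩
    · intro a b hb
      exact ⟨{b}, by simpa using hb, fun φ hφ => by
        rw [TensorProduct.map_tmul, hφ b (Finset.mem_singleton_self b), TensorProduct.tmul_zero]⟩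
    · rintro x y ⟨K, hK, h⟩ ⟨K', hK', h'⟩
      refine ⟨K ∪ K', fun k hk => (Finset.mem_union.mp hk).elim (hK k) (hK' k), fun φ hφ => ?_⟩
      rw [map_add, h φ fun k hk => hφ k (Finset.mem_union_left _ hk),
        h' φ fun k hk => hφ k (Finset.mem_union_right _ hk), add_zero]

/-- The left ideal of forms killed by all endomorphisms vanishing on some finite subset of the
kernel of `ρ`. -/
def killIdeal (ρ : P →ₗ[R] N) : Ideal (ExteriorAlgebra R P) where
  carrier := {ω | ∃ K : Finset P, (∀ k ∈ K, ρ k = 0) ∧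
      ∀ ψ : P →ₗ[R] P, (∀ k ∈ K, ψ k = 0) → ExteriorAlgebra.map ψ ω = 0}
  zero_mem' := ⟨∅, by simp, fun ψ _ => map_zero _⟩
  add_mem' := by
    classical
    rintro x y ⟨K, hK, h⟩ ⟨K', hK', h'⟩
    refine ⟨K ∪ K', fun k hk => (Finset.mem_union.mp hk).elim (hK k) (hK' k), fun φ hφ => ?_⟩
    rw [map_add, h φ fun k hk => hφ k (Finset.mem_union_left _ hk),
      h' φ fun k hk => hφ k (Finset.mem_union_right _ hk), add_zero]
  smul_mem' := by
    rintro a x ⟨K, hK, h⟩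
    exact ⟨K, hK, fun ψ hψ => by rw [smul_eq_mul, map_mul, h ψ hψ, mul_zero]⟩

instance (ρ : P →ₗ[R] N) : (killIdeal ρ).IsTwoSided where
  mul_mem_of_left := by
    rintro x a ⟨K, hK, h⟩
    exact ⟨K, hK, fun ψ hψ => by rw [map_mul, h ψ hψ, zero_mul]⟩

theorem exists_finset_map_eq_zero {ρ : P →ₗ[R] N} (hρ : Function.Surjective ρ)
    {ω : ExteriorAlgebra R P} (hω : ExteriorAlgebra.map ρ ω = 0) :
    ∃ K : Finset P, (∀ k ∈ K, ρ k = 0) ∧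
      ∀ ψ : P →ₗ[R] P, (∀ k ∈ K, ψ k = 0) → ExteriorAlgebra.map ψ ω = 0 := by
  let mk : ExteriorAlgebra R P →ₐ[R] ExteriorAlgebra R P ⧸ killIdeal ρ :=
    Ideal.Quotient.mkₐ R (killIdeal ρ)
  let f₀ : P →ₗ[R] ExteriorAlgebra R P ⧸ killIdeal ρ := mk.toLinearMap ∘ₗ ExteriorAlgebra.ι R
  have hker : LinearMap.ker ρ ≤ LinearMap.ker f₀ := fun k hk => by
    refine Ideal.Quotient.eq_zero_iff_mem.mpr ⟨{k}, by simpa using hk, fun ψ hψ => ?_⟩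
    rw [ExteriorAlgebra.map_apply_ι, hψ k (Finset.mem_singleton_self k), map_zero]
  let f : N →ₗ[R] ExteriorAlgebra R P ⧸ killIdeal ρ :=
    (LinearMap.ker ρ).liftQ f₀ hker ∘ₗ (ρ.quotKerEquivOfSurjective hρ).symm.toLinearMap
  have hf : ∀ p, f (ρ p) = mk (ExteriorAlgebra.ι R p) := fun p => by
    have : (ρ.quotKerEquivOfSurjective hρ).symm (ρ p) = Submodule.Quotient.mk p := by
      rw [LinearEquiv.symm_apply_eq]
      rfl
    simp only [f, LinearMap.comp_apply, LinearEquiv.coe_coe, this]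
    rfl
  have hsq : ∀ n, f n * f n = 0 := fun n => by
    obtain ⟨p, rfl⟩ := hρ n
    rw [hf, ← map_mul, ExteriorAlgebra.ι_sq_zero, map_zero]
  have hcomp : (ExteriorAlgebra.lift R ⟨f, hsq⟩).comp (ExteriorAlgebra.map ρ) = mk := by
    refine ExteriorAlgebra.hom_ext (LinearMap.ext fun p => ?_)
    simp [hf]
  have h0 : mk ω = 0 := by
    rw [← hcomp, AlgHom.comp_apply, hω, map_zero]
  exact Ideal.Quotient.eq_zero_iff_mem.mp h0

theorem exists_finset_qiMap_eq_zero {π : Q →ₗ[R] M} {ρ : P →ₗ[R] N}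
    (hπ : Function.Surjective π) (hρ : Function.Surjective ρ) {s : ℕ}
    {z : (⨂[R]^s Q) ⊗[R] ExteriorAlgebra R P} (hz : qiMap π ρ s z = 0) :
    ∃ (K : Finset Q) (K' : Finset P), (∀ k ∈ K, π k = 0) ∧ (∀ k ∈ K', ρ k = 0) ∧
      ∀ (φ : Q →ₗ[R] Q) (ψ : P →ₗ[R] P), (∀ k ∈ K, φ k = 0) → (∀ k ∈ K', ψ k = 0) →
        qiMap φ ψ s z = 0 := by
  classical
  refine map_eq_zero_induction (powMap_surjective hπ s) (ExteriorAlgebra.map_surjective_iff.mpr hρ)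
    (p := fun z => ∃ (K : Finset Q) (K' : Finset P), (∀ k ∈ K, π k = 0) ∧ (∀ k ∈ K', ρ k = 0) ∧
      ∀ (φ : Q →ₗ[R] Q) (ψ : P →ₗ[R] P), (∀ k ∈ K, φ k = 0) → (∀ k ∈ K', ψ k = 0) →
        qiMap φ ψ s z = 0) ?_ ?_ ?_ hz
  · intro a b ha
    obtain ⟨K, hK, h⟩ := exists_finset_powMap_eq_zero hπ ha
    exact ⟨K, ∅, hK, by simp, fun φ ψ hφ _ => by
      rw [qiMap_tmul, h φ hφ, TensorProduct.zero_tmul]⟩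
  · intro a b hb
    obtain ⟨K, hK, h⟩ := exists_finset_map_eq_zero hρ hb
    exact ⟨∅, K, by simp, hK, fun φ ψ _ hψ => by
      rw [qiMap_tmul, h ψ hψ, TensorProduct.tmul_zero]⟩
  · rintro x y ⟨K, L, hK, hL, h⟩ ⟨K', L', hK', hL', h'⟩
    refine ⟨K ∪ K', L ∪ L', fun k hk => (Finset.mem_union.mp hk).elim (hK k) (hK' k),
      fun k hk => (Finset.mem_union.mp hk).elim (hL k) (hL' k), fun φ ψ hφ hψ => ?_⟩
    rw [map_add, h φ ψ (fun k hk => hφ k (Finset.mem_union_left _ hk))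
      (fun k hk => hψ k (Finset.mem_union_left _ hk)),
      h' φ ψ (fun k hk => hφ k (Finset.mem_union_right _ hk))
      (fun k hk => hψ k (Finset.mem_union_right _ hk)), add_zero]

end Kill

section Flat

variable {R}
variable {X M : Type*} [AddCommGroup M] [Module R M]

/-- Extension by zero from a finite set of coordinates. -/
def extendFinset (S : Finset X) : (S →₀ R) →ₗ[R] (X →₀ R) :=
  Finsupp.lmapDomain R R Subtype.val

/-- Restriction to a finite set of coordinates. -/
def restrictFinset (S : Finset X) : (X →₀ R) →ₗ[R] (S →₀ R) :=
  Finsupp.lcomapDomain Subtype.val Subtype.val_injective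

theorem extendFinset_restrictFinset {S : Finset X} {f : X →₀ R} (hf : f.support ⊆ S) :
    extendFinset S (restrictFinset S f) = f :=
  Finsupp.mapDomain_comapDomain _ Subtype.val_injective f (by simpa using hf)

/-- A presentation of a flat module by a free module can be modified so as to kill finitely many
relations. -/
theorem exists_endomorphism_of_flat [Module.Flat R M] {π : (X →₀ R) →ₗ[R] M}
    (hπ : Function.Surjective π) (K : Finset (X →₀ R)) (hK : ∀ k ∈ K, π k = 0) :
    ∃ φ : (X →₀ R) →ₗ[R] (X →₀ R), π ∘ₗ φ = π ∧ ∀ k ∈ K, φ k = 0 := by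
  classical
  let S : Finset X := K.biUnion Finsupp.support
  have hS : ∀ k ∈ K, extendFinset S (restrictFinset S k) = k := fun k hk =>
    extendFinset_restrictFinset (Finset.subset_biUnion_of_mem Finsupp.support hk)
  let f : (K →₀ R) →ₗ[R] (S →₀ R) :=
    Finsupp.linearCombination R fun k : K => restrictFinset S k.1
  have hf : (π ∘ₗ extendFinset S) ∘ₗ f = 0 := by
    refine Finsupp.lhom_ext' fun k => LinearMap.ext_ring ?_
    simp [f, hS k.1 k.2, hK k.1 k.2]
  obtain ⟨n, a, y, hya, haf⟩ := Module.Flat.exists_factorization_of_comp_eq_zero_of_free hf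
  obtain ⟨y', hy'⟩ := Module.projective_lifting_property π y hπ
  refine ⟨y' ∘ₗ a ∘ₗ restrictFinset S + (LinearMap.id - extendFinset S ∘ₗ restrictFinset S),
    LinearMap.ext fun q => ?_, fun k hk => ?_⟩
  · have h1 : ∀ z, π (y' z) = y z := fun z => LinearMap.congr_fun hy' z
    have h2 : ∀ z, π (extendFinset S z) = y (a z) := fun z => LinearMap.congr_fun hya z
    simp [h1, h2]
  · have h1 : a (restrictFinset S k) = 0 := by
      have := LinearMap.congr_fun haf (Finsupp.single ⟨k, hk⟩ 1)
      simpa [f] using this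
    simp [h1, hS k hk]

end Flat

section Support

variable {R}
variable {Q P : Type*} [AddCommGroup Q] [Module R Q] [AddCommGroup P] [Module R P]

theorem exists_finset_powMap_eq_self {s : ℕ} (t : ⨂[R]^s Q) :
    ∃ S : Finset Q, ∀ φ : Q →ₗ[R] Q, (∀ k ∈ S, φ k = k) → powMap φ s t = t := by
  classical
  induction t using PiTensorProduct.induction_on with
  | smul_tprod r f =>
    refine ⟨Finset.univ.image f, fun φ hφ => ?_⟩
    have h : ∀ i, φ (f i) = f i := fun i => hφ _ (Finset.mem_image_of_mem f (Finset.mem_univ i))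
    simp only [map_smul, powMap_tprod, h]
  | add x y hx hy =>
    obtain ⟨S, hS⟩ := hx
    obtain ⟨T, hT⟩ := hy
    refine ⟨S ∪ T, fun φ hφ => ?_⟩
    rw [map_add, hS φ fun k hk => hφ k (Finset.mem_union_left _ hk),
      hT φ fun k hk => hφ k (Finset.mem_union_right _ hk)]

theorem exists_finset_map_eq_self (ω : ExteriorAlgebra R P) :
    ∃ S : Finset P, ∀ ψ : P →ₗ[R] P, (∀ k ∈ S, ψ k = k) → ExteriorAlgebra.map ψ ω = ω := by
  classical
  induction ω using ExteriorAlgebra.induction with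
  | algebraMap r => exact ⟨∅, fun ψ _ => AlgHom.commutes _ r⟩
  | ι x =>
    refine ⟨{x}, fun ψ hψ => ?_⟩
    rw [ExteriorAlgebra.map_apply_ι, hψ x (Finset.mem_singleton_self x)]
  | mul x y hx hy =>
    obtain ⟨S, hS⟩ := hx
    obtain ⟨T, hT⟩ := hy
    refine ⟨S ∪ T, fun φ hφ => ?_⟩
    rw [map_mul, hS φ fun k hk => hφ k (Finset.mem_union_left _ hk),
      hT φ fun k hk => hφ k (Finset.mem_union_right _ hk)]
  | add x y hx hy =>
    obtain ⟨S, hS⟩ := hx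
    obtain ⟨T, hT⟩ := hy
    refine ⟨S ∪ T, fun φ hφ => ?_⟩
    rw [map_add, hS φ fun k hk => hφ k (Finset.mem_union_left _ hk),
      hT φ fun k hk => hφ k (Finset.mem_union_right _ hk)]

theorem exists_finset_qiMap_eq_self {s : ℕ} (x : (⨂[R]^s Q) ⊗[R] ExteriorAlgebra R P) :
    ∃ (S : Finset Q) (S' : Finset P), ∀ (φ : Q →ₗ[R] Q) (ψ : P →ₗ[R] P),
      (∀ k ∈ S, φ k = k) → (∀ k ∈ S', ψ k = k) → qiMap φ ψ s x = x := by
  classical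
  induction x using TensorProduct.induction_on with
  | zero => exact ⟨∅, ∅, fun φ ψ _ _ => map_zero _⟩
  | tmul t ω =>
    obtain ⟨S, hS⟩ := exists_finset_powMap_eq_self t
    obtain ⟨T, hT⟩ := exists_finset_map_eq_self ω
    exact ⟨S, T, fun φ ψ hφ hψ => by rw [qiMap_tmul, hS φ hφ, hT ψ hψ]⟩
  | add x y hx hy =>
    obtain ⟨S, S', hS⟩ := hx
    obtain ⟨T, T', hT⟩ := hy
    refine ⟨S ∪ T, S' ∪ T', fun φ ψ hφ hψ => ?_⟩
    rw [map_add, hS φ ψ (fun k hk => hφ k (Finset.mem_union_left _ hk))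
      (fun k hk => hψ k (Finset.mem_union_left _ hk)),
      hT φ ψ (fun k hk => hφ k (Finset.mem_union_right _ hk))
      (fun k hk => hψ k (Finset.mem_union_right _ hk))]

end Support

section Lift

variable {R}
variable {Q M P N : Type*} [AddCommGroup Q] [Module R Q] [AddCommGroup M] [Module R M]
  [AddCommGroup P] [Module R P] [AddCommGroup N] [Module R N]

theorem exists_symTensor_lift {π : Q →ₗ[R] M} (hπ : Function.Surjective π)
    (hkill : ∀ K : Finset Q, (∀ k ∈ K, π k = 0) →
      ∃ φ : Q →ₗ[R] Q, π ∘ₗ φ = π ∧ ∀ k ∈ K, φ k = 0)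
    {s : ℕ} {t : ⨂[R]^s M} (ht : t ∈ SymTensor R M s) :
    ∃ t' ∈ SymTensor R Q s, powMap π s t' = t := by
  classical
  obtain ⟨z, rfl⟩ := powMap_surjective hπ s t
  choose K hK hKz using fun σ : Equiv.Perm (Fin s) =>
    exists_finset_powMap_eq_zero hπ (z := PiTensorProduct.reindex R (fun _ => Q) σ z - z)
      (by rw [map_sub, powMap_reindex, ht σ, sub_self])
  obtain ⟨φ, hφ, hφK⟩ := hkill (Finset.univ.biUnion K) fun k hk => by
    obtain ⟨σ, -, hσ⟩ := Finset.mem_biUnion.mp hk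
    exact hK σ k hσ
  refine ⟨powMap φ s z, fun σ => ?_, by rw [powMap_comp_apply, hφ]⟩
  have := hKz σ φ fun k hk => hφK k (Finset.mem_biUnion.mpr ⟨σ, Finset.mem_univ σ, hk⟩)
  rwa [map_sub, powMap_reindex, sub_eq_zero] at this

theorem exists_exteriorPower_lift {ρ : P →ₗ[R] N} (hρ : Function.Surjective ρ) {l : ℕ}
    {ω : ExteriorAlgebra R N} (hω : ω ∈ ⋀[R]^l N) :
    ∃ ω' ∈ ⋀[R]^l P, ExteriorAlgebra.map ρ ω' = ω := by
  have h : ⋀[R]^l N ≤ (⋀[R]^l P).map (ExteriorAlgebra.map ρ).toLinearMap := by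
    rw [Submodule.map_pow, ExteriorAlgebra.ι_range_map_map, LinearMap.range_eq_top.mpr hρ,
      Submodule.map_top]
  exact h hω

theorem exists_qiTerm_lift {π : Q →ₗ[R] M} {ρ : P →ₗ[R] N} (hπ : Function.Surjective π)
    (hρ : Function.Surjective ρ)
    (hkill : ∀ K : Finset Q, (∀ k ∈ K, π k = 0) →
      ∃ φ : Q →ₗ[R] Q, π ∘ₗ φ = π ∧ ∀ k ∈ K, φ k = 0)
    {s l : ℕ} {x : (⨂[R]^s M) ⊗[R] ExteriorAlgebra R N} (hx : x ∈ qiTerm R M N s l) :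
    ∃ x' ∈ qiTerm R Q P s l, qiMap π ρ s x' = x := by
  rw [qiTerm_eq_span] at hx
  induction hx using Submodule.span_induction with
  | mem x h =>
    obtain ⟨t, ht, ω, hω, rfl⟩ := h
    obtain ⟨t', ht', rfl⟩ := exists_symTensor_lift hπ hkill ht
    obtain ⟨ω', hω', rfl⟩ := exists_exteriorPower_lift hρ hω
    exact ⟨t' ⊗ₜ ω', tmul_mem_qiTerm ht' hω', rfl⟩
  | zero => exact ⟨0, zero_mem _, map_zero _⟩
  | add x y _ _ hx hy =>
    obtain ⟨x', hx', rfl⟩ := hx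
    obtain ⟨y', hy', rfl⟩ := hy
    exact ⟨x' + y', add_mem hx' hy', map_add _ _ _⟩
  | smul r x _ hx =>
    obtain ⟨x', hx', rfl⟩ := hx
    exact ⟨r • x', Submodule.smul_mem _ r hx', map_smul _ _ _⟩

end Lift

section Descent

variable {R E F G}

/-- Compatible presentations of a short exact sequence of flat modules can be modified so as to
kill finitely many relations. -/
theorem exists_endomorphisms_of_flat [Module.Flat R E] [Module.Flat R G]
    {u : E →ₗ[R] F} {v : F →ₗ[R] G} (hu : Function.Injective u)
    (huv : LinearMap.range u = LinearMap.ker v) {X Y : Type*}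
    {π : (X →₀ R) →ₗ[R] E} {ρ : (Y →₀ R) →ₗ[R] F} (hπ : Function.Surjective π)
    (hρ : Function.Surjective (v ∘ₗ ρ))
    (K : Finset ((X →₀ R) × (Y →₀ R))) (K' : Finset (Y →₀ R))
    (hK : ∀ k ∈ K, (u ∘ₗ π).coprod ρ k = 0) (hK' : ∀ k ∈ K', v (ρ k) = 0) :
    ∃ (φ : (X →₀ R) →ₗ[R] (X →₀ R))
      (φ' : (X →₀ R) × (Y →₀ R) →ₗ[R] (X →₀ R) × (Y →₀ R))
      (ψ : (Y →₀ R) →ₗ[R] (Y →₀ R)),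
      π ∘ₗ φ = π ∧ (u ∘ₗ π).coprod ρ ∘ₗ φ' = (u ∘ₗ π).coprod ρ ∧
      (v ∘ₗ ρ) ∘ₗ ψ = v ∘ₗ ρ ∧
      φ' ∘ₗ LinearMap.inl R _ _ = LinearMap.inl R _ _ ∘ₗ φ ∧
      LinearMap.snd R _ _ ∘ₗ φ' = ψ ∘ₗ LinearMap.snd R _ _ ∧
      (∀ k ∈ K, φ' k = 0) ∧ ∀ k ∈ K', ψ k = 0 := by
  classical
  have hvu : ∀ e, v (u e) = 0 := fun e => by
    have : u e ∈ LinearMap.ker v := huv ▸ ⟨e, rfl⟩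
    exact this
  obtain ⟨ψ, hψ, hψK⟩ := exists_endomorphism_of_flat hρ (K' ∪ K.image Prod.snd) (by
    intro k hk
    rcases Finset.mem_union.mp hk with hk | hk
    · exact hK' k hk
    · obtain ⟨q, hq, rfl⟩ := Finset.mem_image.mp hk
      have := congrArg v (hK q hq)
      simpa [hvu] using this)
  have hex : ∀ y : Y, ∃ e, u (π e) = ρ (Finsupp.single y 1) - ρ (ψ (Finsupp.single y 1)) := by
    intro y
    have h : ρ (Finsupp.single y 1) - ρ (ψ (Finsupp.single y 1)) ∈ LinearMap.range u := by
      rw [huv, LinearMap.mem_ker, map_sub, sub_eq_zero]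
      exact (LinearMap.congr_fun hψ _).symm
    obtain ⟨e', he'⟩ := h
    obtain ⟨e, rfl⟩ := hπ e'
    exact ⟨e, he'⟩
  choose d hd using hex
  let δ : (Y →₀ R) →ₗ[R] (X →₀ R) := Finsupp.linearCombination R d
  have hδ : ∀ p, u (π (δ p)) = ρ p - ρ (ψ p) := fun p => by
    have : u ∘ₗ π ∘ₗ δ = ρ - ρ ∘ₗ ψ := by
      refine Finsupp.lhom_ext' fun y => LinearMap.ext_ring ?_
      simp [δ, hd]
    exact LinearMap.congr_fun this p
  obtain ⟨φ, hφ, hφK⟩ := exists_endomorphism_of_flat hπ (K.image fun k => k.1 + δ k.2) (by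
    intro k hk
    obtain ⟨q, hq, rfl⟩ := Finset.mem_image.mp hk
    apply hu
    have h1 := hK q hq
    rw [LinearMap.coprod_apply, LinearMap.comp_apply] at h1
    have h2 : ψ q.2 = 0 :=
      hψK _ (Finset.mem_union_right _ (Finset.mem_image_of_mem Prod.snd hq))
    rw [map_add, map_add, hδ, h2, map_zero, sub_zero, h1, map_zero])
  have hφK' : ∀ k ∈ K, φ (k.1 + δ k.2) = 0 := fun k hk =>
    hφK _ (Finset.mem_image.mpr ⟨k, hk, rfl⟩)
  have hφ' : ∀ e, π (φ e) = π e := fun e => LinearMap.congr_fun hφ e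
  refine ⟨φ, (φ ∘ₗ (LinearMap.id.coprod δ)).prod (ψ ∘ₗ LinearMap.snd R _ _), ψ, hφ, ?_, hψ,
    ?_, ?_, fun k hk => ?_, fun k hk => hψK k (Finset.mem_union_left _ hk)⟩
  · refine LinearMap.ext fun q => ?_
    simp [hφ', hδ, add_assoc]
  · refine LinearMap.ext fun e => ?_
    simp
  · refine LinearMap.ext fun e => ?_
    simp
  · refine Prod.ext ?_ ?_
    · simpa using hφK' k hk
    · exact hψK _ (Finset.mem_union_right _ (Finset.mem_image_of_mem Prod.snd hk))

variable {u : E →ₗ[R] F} {v : F →ₗ[R] G}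

theorem comp_coprod_eq (huv : LinearMap.range u = LinearMap.ker v) {Q P : Type*}
    [AddCommGroup Q] [Module R Q] [AddCommGroup P] [Module R P]
    (a : Q →ₗ[R] E) (ρ : P →ₗ[R] F) :
    v ∘ₗ (u ∘ₗ a).coprod ρ = (v ∘ₗ ρ) ∘ₗ LinearMap.snd R Q P := by
  refine LinearMap.ext fun q => ?_
  have : u (a q.1) ∈ LinearMap.ker v := huv ▸ ⟨a q.1, rfl⟩
  rw [LinearMap.mem_ker] at this
  simp [this]

theorem coprod_surjective (huv : LinearMap.range u = LinearMap.ker v) {Q P : Type*}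
    [AddCommGroup Q] [Module R Q] [AddCommGroup P] [Module R P]
    {a : Q →ₗ[R] E} {ρ : P →ₗ[R] F} (ha : Function.Surjective a)
    (hρ : Function.Surjective (v ∘ₗ ρ)) : Function.Surjective ((u ∘ₗ a).coprod ρ) := by
  intro f
  obtain ⟨p, hp⟩ := hρ (v f)
  have h : f - ρ p ∈ LinearMap.range u := by
    rw [huv, LinearMap.mem_ker, map_sub, sub_eq_zero]
    exact hp.symm
  obtain ⟨e, he⟩ := h
  obtain ⟨q, rfl⟩ := ha e
  exact ⟨(q, p), by simp [he]⟩

theorem exists_lift_comp_surjective (hv : Function.Surjective v) :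
    ∃ ρ : (G →₀ R) →ₗ[R] F, Function.Surjective (v ∘ₗ ρ) := by
  choose w hw using hv
  exact ⟨Finsupp.linearCombination R w, fun g => ⟨Finsupp.single g 1, by simp [hw]⟩⟩

theorem linearCombination_id_surjective :
    Function.Surjective (Finsupp.linearCombination R (id : E → E)) :=
  fun e => ⟨Finsupp.single e 1, by simp⟩

/-- Every element of a term of the complex, and every relation `d x = 0`, comes from a split
sequence of finite free modules. -/
theorem exists_finite_free_lift [Module.Flat R E] [Module.Flat R G]
    (hu : Function.Injective u) (hv : Function.Surjective v)
    (huv : LinearMap.range u = LinearMap.ker v) {s l : ℕ}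
    {x : (⨂[R]^(s + 1) F) ⊗[R] ExteriorAlgebra R G} (hx : x ∈ qiTerm R F G (s + 1) l) :
    ∃ (S : Finset E) (S' : Finset G) (a : (S →₀ R) →ₗ[R] E) (ρ : (S' →₀ R) →ₗ[R] F),
      ∃ x' ∈ qiTerm R ((S →₀ R) × (S' →₀ R)) (S' →₀ R) (s + 1) l,
        qiMap ((u ∘ₗ a).coprod ρ) (v ∘ₗ ρ) (s + 1) x' = x ∧
        (qiDiff v s x = 0 → qiDiff (LinearMap.snd R (S →₀ R) (S' →₀ R)) s x' = 0) := by
  classical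
  obtain ⟨ρ, hρ⟩ := exists_lift_comp_surjective hv
  let π : (E →₀ R) →ₗ[R] E := Finsupp.linearCombination R id
  have hπ : Function.Surjective π := linearCombination_id_surjective
  let θ := (u ∘ₗ π).coprod ρ
  have hθ : Function.Surjective θ := coprod_surjective huv hπ hρ
  have hθv : v ∘ₗ θ = (v ∘ₗ ρ) ∘ₗ LinearMap.snd R _ _ := comp_coprod_eq huv π ρ
  have hlift : ∃ x₀ ∈ qiTerm R ((E →₀ R) × (G →₀ R)) (G →₀ R) (s + 1) l,
      qiMap θ (v ∘ₗ ρ) (s + 1) x₀ = x ∧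
        (qiDiff v s x = 0 → qiDiff (LinearMap.snd R (E →₀ R) (G →₀ R)) s x₀ = 0) := by
    obtain ⟨x₀, hx₀, rfl⟩ := exists_qiTerm_lift hθ hρ (fun K hK => by
      obtain ⟨-, φ', -, -, h, -, -, -, hk, -⟩ :=
        exists_endomorphisms_of_flat hu huv hπ hρ K ∅ hK (by simp)
      exact ⟨φ', h, hk⟩) hx
    by_cases hdx : qiDiff v s (qiMap θ (v ∘ₗ ρ) (s + 1) x₀) = 0
    · have hdx' := hdx
      rw [qiMap_qiDiff hθv] at hdx'
      obtain ⟨K, K', hK, hK', h⟩ := exists_finset_qiMap_eq_zero hθ hρ hdx'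
      obtain ⟨-, φ', ψ, -, h₁, h₂, -, h₃, hk, hk'⟩ :=
        exists_endomorphisms_of_flat hu huv hπ hρ K K' hK hK'
      refine ⟨qiMap φ' ψ (s + 1) x₀, qiMap_mem_qiTerm _ _ hx₀, ?_, fun _ => ?_⟩
      · rw [qiMap_comp_apply, h₁, h₂]
      · rw [qiMap_qiDiff h₃, h φ' ψ hk hk']
    · exact ⟨x₀, hx₀, rfl, fun h => absurd h hdx⟩
  obtain ⟨x₀, hx₀, rfl, hdx₀⟩ := hlift
  obtain ⟨T, T', hT⟩ := exists_finset_qiMap_eq_self x₀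
  let S : Finset E := T.biUnion fun k => k.1.support
  let S' : Finset G := T.biUnion (fun k => k.2.support) ∪ T'.biUnion Finsupp.support
  let i := (extendFinset (R := R) S).prodMap (extendFinset (R := R) S')
  let r := (restrictFinset (R := R) S).prodMap (restrictFinset (R := R) S')
  have hir : qiMap i (extendFinset S') (s + 1) (qiMap r (restrictFinset S') (s + 1) x₀) = x₀ := by
    rw [qiMap_comp_apply]
    refine hT _ _ (fun k hk => Prod.ext ?_ ?_) fun k hk => ?_
    · exact extendFinset_restrictFinset
        (Finset.subset_biUnion_of_mem (fun k : (E →₀ R) × (G →₀ R) => k.1.support) hk)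
    · exact extendFinset_restrictFinset ((Finset.subset_biUnion_of_mem
        (fun k : (E →₀ R) × (G →₀ R) => k.2.support) hk).trans Finset.subset_union_left)
    · exact extendFinset_restrictFinset ((Finset.subset_biUnion_of_mem
        Finsupp.support hk).trans Finset.subset_union_right)
  refine ⟨S, S', π ∘ₗ extendFinset S, ρ ∘ₗ extendFinset S', qiMap r (restrictFinset S') (s + 1) x₀,
    qiMap_mem_qiTerm _ _ hx₀, ?_, fun h => ?_⟩
  · have h1 : (u ∘ₗ π ∘ₗ extendFinset S).coprod (ρ ∘ₗ extendFinset S') = θ ∘ₗ i :=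
      LinearMap.ext fun q => by simp [θ, i]
    rw [h1, ← LinearMap.comp_assoc, ← qiMap_comp_apply, hir]
  · have hr : LinearMap.snd R (S →₀ R) (S' →₀ R) ∘ₗ r =
        restrictFinset S' ∘ₗ LinearMap.snd R (E →₀ R) (G →₀ R) := LinearMap.ext fun _ => rfl
    rw [qiMap_qiDiff hr, hdx₀ h, map_zero]

end Descent

section Exactness

variable {R E F G}

/-- The standard basis of `R^S × R^S'`. -/
def prodBasis (S S' : Type*) : Module.Basis (S ⊕ S') R ((S →₀ R) × (S' →₀ R)) :=
  Finsupp.basisSingleOne.prod Finsupp.basisSingleOne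

theorem prodBasis_inl {S S' : Type*} (i : S) :
    prodBasis (R := R) S S' (Sum.inl i) = (Finsupp.single i 1, 0) := by
  simp [prodBasis, Module.Basis.prod_apply]

theorem prodBasis_inr {S S' : Type*} (j : S') :
    prodBasis (R := R) S S' (Sum.inr j) = (0, Finsupp.single j 1) := by
  simp [prodBasis, Module.Basis.prod_apply]

theorem snd_prodBasis_inl {S S' : Type*} (i : S) :
    LinearMap.snd R (S →₀ R) (S' →₀ R) (prodBasis S S' (Sum.inl i)) = 0 := by
  simp [prodBasis_inl]

theorem snd_prodBasis_inr {S S' : Type*} (j : S') :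
    LinearMap.snd R (S →₀ R) (S' →₀ R) (prodBasis S S' (Sum.inr j)) =
      Finsupp.basisSingleOne (R := R) j := by
  simp [prodBasis_inr]

theorem exists_symTensor_of_mem_qiTerm_zero {M N : Type*} [AddCommGroup M] [AddCommGroup N]
    [Module R M] [Module R N] {s : ℕ} {x : (⨂[R]^s M) ⊗[R] ExteriorAlgebra R N}
    (hx : x ∈ qiTerm R M N s 0) :
    ∃ t ∈ SymTensor R M s, t ⊗ₜ[R] (1 : ExteriorAlgebra R N) = x := by
  rw [qiTerm_eq_span] at hx
  induction hx using Submodule.span_induction with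
  | mem x h =>
    obtain ⟨t, ht, ω, hω, rfl⟩ := h
    obtain ⟨r, rfl⟩ := mem_exteriorPower_zero hω
    exact ⟨r • t, Submodule.smul_mem _ r ht, by
      rw [TensorProduct.smul_tmul, Algebra.algebraMap_eq_smul_one]⟩
  | zero => exact ⟨0, zero_mem _, TensorProduct.zero_tmul _ _⟩
  | add x y _ _ hx hy =>
    obtain ⟨t, ht, rfl⟩ := hx
    obtain ⟨t', ht', rfl⟩ := hy
    exact ⟨t + t', add_mem ht ht', TensorProduct.add_tmul _ _ _⟩
  | smul r x _ hx =>
    obtain ⟨t, ht, rfl⟩ := hx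
    exact ⟨r • t, Submodule.smul_mem _ r ht, TensorProduct.smul_tmul' _ _ _⟩

theorem mem_symTensor_one {M : Type*} [AddCommGroup M] [Module R M] (x : ⨂[R]^1 M) :
    x ∈ SymTensor R M 1 := by
  intro σ
  rw [Subsingleton.elim σ (Equiv.refl _), PiTensorProduct.reindex_refl]
  rfl

theorem exists_qiDiff_eq_of_mem_qiTerm_zero_left {v : F →ₗ[R] G} (hv : Function.Surjective v)
    {l : ℕ} {x : (⨂[R]^0 F) ⊗[R] ExteriorAlgebra R G} (hx : x ∈ qiTerm R F G 0 (l + 1)) :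
    ∃ y ∈ qiTerm R F G 1 l, qiDiff v 0 y = x := by
  have hle : qiTerm R F G 0 (l + 1) ≤ (qiTerm R F G 1 l).map (qiDiff v 0) := by
    rw [qiTerm_eq_span, Submodule.span_le]
    rintro _ ⟨t, -, ω, hω, rfl⟩
    refine exteriorPower_succ_induction
      (p := fun ω => t ⊗ₜ[R] ω ∈ (qiTerm R F G 1 l).map (qiDiff v 0))
      (fun g ω hω => ?_) (fun a b ha hb => ?_) hω
    · obtain ⟨f, rfl⟩ := hv g
      exact ⟨(splitPow R F 0).symm (t ⊗ₜ[R] f) ⊗ₜ[R] ω, tmul_mem_qiTerm (mem_symTensor_one _) hω,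
        by simp [qiDiff, wedgeContract]⟩
    · rw [TensorProduct.tmul_add]
      exact add_mem ha hb
  exact hle hx

variable {u : E →ₗ[R] F} {v : F →ₗ[R] G}

theorem powMap_eq_zero_of_injective [Module.Flat R E] [Module.Flat R G]
    (hu : Function.Injective u) (hv : Function.Surjective v)
    (huv : LinearMap.range u = LinearMap.ker v) {n : ℕ} {y : ⨂[R]^n E}
    (hy : powMap u n y = 0) : y = 0 := by
  obtain ⟨ρ, hρ⟩ := exists_lift_comp_surjective hv
  let π : (E →₀ R) →ₗ[R] E := Finsupp.linearCombination R id
  have hπ : Function.Surjective π := linearCombination_id_surjective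
  obtain ⟨y₀, rfl⟩ := powMap_surjective hπ n y
  have h₀ : powMap ((u ∘ₗ π).coprod ρ) n (powMap (LinearMap.inl R _ _) n y₀) = 0 := by
    rw [powMap_comp_apply, LinearMap.coprod_inl, ← powMap_comp_apply, hy]
  obtain ⟨K, hK, h⟩ := exists_finset_powMap_eq_zero (coprod_surjective huv hπ hρ) h₀
  obtain ⟨φ, φ', -, h₁, -, -, h₂, -, hk, -⟩ :=
    exists_endomorphisms_of_flat hu huv hπ hρ K ∅ hK (by simp)
  have h₃ := h φ' hk
  rw [powMap_comp_apply, h₂] at h₃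
  have h₄ := congrArg (powMap (LinearMap.fst R (E →₀ R) (G →₀ R)) n) h₃
  rw [powMap_comp_apply, ← LinearMap.comp_assoc, LinearMap.fst_comp_inl, LinearMap.id_comp,
    map_zero] at h₄
  rw [← h₁, ← powMap_comp_apply, h₄, map_zero]

variable [Module.Flat R E] [Module.Flat R G]

theorem qiDiff_mem_qiTerm (hu : Function.Injective u)
    (hv : Function.Surjective v) (huv : LinearMap.range u = LinearMap.ker v) {s l : ℕ}
    {x : (⨂[R]^(s + 1) F) ⊗[R] ExteriorAlgebra R G} (hx : x ∈ qiTerm R F G (s + 1) l) :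
    qiDiff v s x ∈ qiTerm R F G s (l + 1) := by
  obtain ⟨S, S', a, ρ, x, hx', rfl, -⟩ := exists_finite_free_lift hu hv huv hx
  rw [qiMap_qiDiff (comp_coprod_eq huv a ρ)]
  exact qiMap_mem_qiTerm _ _ (qiDiff_mem_of_basis (prodBasis S S') _ hx')

theorem qiDiff_qiDiff (hu : Function.Injective u)
    (hv : Function.Surjective v) (huv : LinearMap.range u = LinearMap.ker v) {s l : ℕ}
    {x : (⨂[R]^(s + 2) F) ⊗[R] ExteriorAlgebra R G} (hx : x ∈ qiTerm R F G (s + 2) l) :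
    qiDiff v s (qiDiff v (s + 1) x) = 0 := by
  obtain ⟨S, S', a, ρ, x, hx', rfl, -⟩ := exists_finite_free_lift hu hv huv hx
  rw [qiMap_qiDiff (comp_coprod_eq huv a ρ), qiMap_qiDiff (comp_coprod_eq huv a ρ),
    qiDiff_qiDiff_of_basis (prodBasis S S') _ hx', map_zero]

theorem exists_qiDiff_eq (hu : Function.Injective u)
    (hv : Function.Surjective v) (huv : LinearMap.range u = LinearMap.ker v) {s l : ℕ}
    {x : (⨂[R]^(s + 1) F) ⊗[R] ExteriorAlgebra R G} (hx : x ∈ qiTerm R F G (s + 1) (l + 1))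
    (hdx : qiDiff v s x = 0) :
    ∃ y ∈ qiTerm R F G (s + 2) l, qiDiff v (s + 1) y = x := by
  obtain ⟨S, S', a, ρ, x, hx', rfl, h⟩ := exists_finite_free_lift hu hv huv hx
  obtain ⟨y, hy, rfl⟩ := exists_qiDiff_eq_of_basis (prodBasis S S') Finsupp.basisSingleOne _
    snd_prodBasis_inl snd_prodBasis_inr hx' (h hdx)
  exact ⟨_, qiMap_mem_qiTerm _ _ hy, qiMap_qiDiff (comp_coprod_eq huv a ρ) _ _⟩

theorem exists_powMap_tmul_one_eq (hu : Function.Injective u)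
    (hv : Function.Surjective v) (huv : LinearMap.range u = LinearMap.ker v) {s : ℕ}
    {x : (⨂[R]^(s + 1) F) ⊗[R] ExteriorAlgebra R G} (hx : x ∈ qiTerm R F G (s + 1) 0)
    (hdx : qiDiff v s x = 0) :
    ∃ y ∈ SymTensor R E (s + 1), x = powMap u (s + 1) y ⊗ₜ[R] (1 : ExteriorAlgebra R G) := by
  obtain ⟨S, S', a, ρ, x, hx', rfl, h⟩ := exists_finite_free_lift hu hv huv hx
  have hself := qiMap_eq_self_of_basis (prodBasis S S') Finsupp.basisSingleOne _
    snd_prodBasis_inl snd_prodBasis_inr (LinearMap.inl R _ _ ∘ₗ LinearMap.fst R _ _)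
    (fun i => by simp [prodBasis_inl]) hx' (h hdx)
  obtain ⟨t, ht, rfl⟩ := exists_symTensor_of_mem_qiTerm_zero hx'
  refine ⟨powMap (a ∘ₗ LinearMap.fst R _ _) (s + 1) t, powMap_mem_symTensor _ _ ht, ?_⟩
  rw [← hself, qiMap_comp_apply, qiMap_tmul, map_one, powMap_comp_apply, ← LinearMap.comp_assoc,
    LinearMap.coprod_inl, LinearMap.comp_assoc]

end Exactness

end QuillenIllusie

/-- **Quillen–Illusie exact sequence.** Let `0 → E → F → G → 0` be a short exact
sequence of flat `R`-modules.  For every `n ≥ 0` the sequence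
`0 → Γ^n(E) → Γ^n(F) → Γ^{n−1}(F) ⊗ G → ⋯ → Γ^{n−i}(F) ⊗ ∧^i G → ⋯ → ∧^n G → 0`
is exact, where `Γ` is the divided power functor (realized for flat modules as symmetric
tensors) and the differentials are as in `qiDiff`.  Exactness is expressed as: the
differentials map each term to the next one, compose to zero, `Γ^n(E) → Γ^n(F)` is
injective with image the kernel of the first differential, the sequence is exact at all
interior terms, and the last differential is surjective onto `∧^n G`. -/
theorem stmt_14
    [Module.Flat R E] [Module.Flat R F] [Module.Flat R G]
    (u : E →ₗ[R] F) (v : F →ₗ[R] G)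
    (hu : Function.Injective u) (hv : Function.Surjective v)
    (huv : LinearMap.range u = LinearMap.ker v)
    (n : ℕ) :
    -- the differential maps `Γ^{s+1}F ⊗ ∧^l G` into `Γ^s F ⊗ ∧^{l+1} G`
    (∀ s l : ℕ, ∀ x ∈ qiTerm R F G (s + 1) l,
        qiDiff v s x ∈ qiTerm R F G s (l + 1)) ∧
    -- the composite of two successive differentials vanishes on the divided-power terms
    (∀ s l : ℕ, ∀ x ∈ qiTerm R F G (s + 2) l,
        qiDiff v s (qiDiff v (s + 1) x) = 0) ∧
    -- `0 → Γ^n(E) → Γ^n(F)` : injectivity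
    (∀ y ∈ SymTensor R E n,
        PiTensorProduct.map (fun _ : Fin n => u) y = 0 → y = 0) ∧
    -- `Γ^n E` maps into the symmetric tensors of `F`
    (∀ y ∈ SymTensor R E n, PiTensorProduct.map (fun _ : Fin n => u) y ∈ SymTensor R F n) ∧
    -- exactness at `Γ^n(F)` (the term `(s, l) = (n, 0)`, for `n = t + 1`)
    (∀ t : ℕ, t + 1 = n →
      ∀ x ∈ qiTerm R F G (t + 1) 0, qiDiff v t x = 0 →
        ∃ y ∈ SymTensor R E (t + 1),
          x = (PiTensorProduct.map (fun _ : Fin (t + 1) => u) y) ⊗ₜ[R]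
            (1 : ExteriorAlgebra R G)) ∧
    -- exactness at the interior terms `Γ^{s+1}(F) ⊗ ∧^{l+1}(G)` with `(s+1)+(l+1) = n`
    (∀ s l : ℕ, (s + 1) + (l + 1) = n →
      ∀ x ∈ qiTerm R F G (s + 1) (l + 1), qiDiff v s x = 0 →
        ∃ y ∈ qiTerm R F G (s + 2) l, qiDiff v (s + 1) y = x) ∧
    -- surjectivity onto the last term `∧^n(G)` (the term `(0, n)`, for `n = l + 1`)
    (∀ l : ℕ, l + 1 = n →
      ∀ x ∈ qiTerm R F G 0 (l + 1), ∃ y ∈ qiTerm R F G 1 l, qiDiff v 0 y = x) := by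
  refine ⟨fun s l x hx => ?_, fun s l x hx => ?_, fun y _ hy => ?_, fun y hy => ?_,
    fun t _ x hx hdx => ?_, fun s l _ x hx hdx => ?_, fun l _ x hx => ?_⟩
  · exact QuillenIllusie.qiDiff_mem_qiTerm hu hv huv hx
  · exact QuillenIllusie.qiDiff_qiDiff hu hv huv hx
  · exact QuillenIllusie.powMap_eq_zero_of_injective hu hv huv hy
  · exact QuillenIllusie.powMap_mem_symTensor u n hy
  · exact QuillenIllusie.exists_powMap_tmul_one_eq hu hv huv hx hdx
  · exact QuillenIllusie.exists_qiDiff_eq hu hv huv hx hdx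
  · exact QuillenIllusie.exists_qiDiff_eq_of_mem_qiTerm_zero_left hv hx

end
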